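/- Let n ≥ 1 be an odd integer and let k ≥ 2 and c be integers. Then 𝒩_{k,c,2}(n) = (−1)^{kω(n)} · ∏_{p|n} p^{k·ν_p(n) − ν_p(n) − k} · [ (2−p)^k − Σ_{i=0}^{⌊k/2⌋} (−1)^{(p−1)i/2} p^i · C(k,2i) · ( 2^{k−2i} − p · Σ_{0 ≤ j ≤ k−2i, p | (j−c)} C(k−2i, j) ) − Σ_{i=0}^{⌊(k−1)/2⌋} (−1)^{(p−1)(i+1)/2} p^{i+1} · C(k,2i+1) · Σ_{0 ≤ j ≤ k−2i−1, p ∤ (j−c)} C(k−2i−1, j) · ((j−c)/p) ], where the products and sums over p range over the distinct prime divisors of n, ((j−c)/p) denotes the Legendre symbol, C(a,b) denotes the binomial coefficient, ω(n) is the number of distinct prime divisors of n, and ν_p(n) is the p-adic valuation of n. -/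

import Mathlib

/-- `excCount k c e n` is 𝒩_{k,c,e}(n): the number of `k`-tuples of exceptional
units of `ℤ_n` (i.e. elements `u` with both `u` and `1 - u` units) whose `e`-th
powers sum to `c` modulo `n`. -/
noncomputable def excCount (k : ℕ) (c : ℤ) (e : ℕ) (n : ℕ) : ℕ :=
  Nat.card {x : Fin k → ZMod n //
    (∀ i, IsUnit (x i) ∧ IsUnit (1 - x i)) ∧ ∑ i, (x i) ^ e = (c : ZMod n)}

section

open Finset

section SumSqCount

variable {R S : Type*} [CommRing R] [CommRing S]

/-- The number of `k`-tuples of exceptional units of `R` whose squares sum to `c`. -/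
noncomputable def sumSqCount (R : Type*) [CommRing R] (k : ℕ) (c : R) : ℕ :=
  Nat.card {x : Fin k → R // (∀ i, IsUnit (x i) ∧ IsUnit (1 - x i)) ∧ ∑ i, x i ^ 2 = c}

theorem sumSqCount_congr (e : R ≃+* S) (k : ℕ) (c : R) :
    sumSqCount S k (e c) = sumSqCount R k c := by
  refine (Nat.card_congr (((Equiv.refl (Fin k)).arrowCongr e.toEquiv).subtypeEquiv fun x ↦ ?_)).symm
  have h (y : R) : IsUnit (1 - e y) ↔ IsUnit (1 - y) := by
    rw [← map_one e, ← map_sub, MulEquiv.isUnit_map]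
  simp [h, ← map_pow, ← map_sum]

theorem sumSqCount_prod (k : ℕ) (c : R × S) :
    sumSqCount (R × S) k c = sumSqCount R k c.1 * sumSqCount S k c.2 := by
  simp only [sumSqCount]
  rw [← Nat.card_prod]
  refine Nat.card_congr (((Equiv.arrowProdEquivProdArrow (Fin k) (fun _ ↦ R) fun _ ↦ S).subtypeEquiv
    fun x ↦ ?_).trans Equiv.subtypeProdEquivProd)
  simp only [Prod.isUnit_iff, Prod.ext_iff, Prod.fst_sum, Prod.snd_sum,
    Equiv.arrowProdEquivProdArrow]
  simp only [Prod.fst_sub, Prod.snd_sub, Prod.fst_one, Prod.snd_one, Prod.pow_fst, Prod.pow_snd,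
    Equiv.coe_fn_mk, forall_and]
  tauto

open Classical in
theorem sumSqCount_succ [Fintype R] (k : ℕ) (c : R) :
    sumSqCount R (k + 1) c =
      ∑ u : R with IsUnit u ∧ IsUnit (1 - u), sumSqCount R k (c - u ^ 2) := by
  rw [← Finset.sum_coe_sort]
  simp only [sumSqCount]
  rw [← Nat.card_sigma]
  refine Nat.card_congr
    { toFun x := ⟨⟨x.1 0, by simpa using x.2.1 0⟩, fun i ↦ x.1 i.succ, fun i ↦ x.2.1 _, ?_⟩
      invFun y := ⟨Fin.cons y.1.1 y.2.1, ?_, ?_⟩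
      left_inv x := ?_
      right_inv y := ?_ }
  · exact eq_sub_of_add_eq' (by rw [← Fin.sum_univ_succ (fun i ↦ x.1 i ^ 2), x.2.2])
  · exact Fin.cases (by exact (Finset.mem_filter.1 y.1.2).2) (by simpa using y.2.2.1)
  · simp [Fin.sum_univ_succ, y.2.2.2]
  · exact Subtype.ext (Fin.cons_self_tail x.1)
  · rfl

theorem sumSqCount_zero (c : R) [Decidable (c = 0)] : sumSqCount R 0 c = if c = 0 then 1 else 0 := by
  split_ifs with h
  · simp [sumSqCount, h]
  · simp [sumSqCount, Ne.symm h]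

open Classical in
theorem sumSqCount_one [Fintype R] (c : R) :
    sumSqCount R 1 c = #{u : R | (IsUnit u ∧ IsUnit (1 - u)) ∧ u ^ 2 = c} := by
  simp [sumSqCount_succ, sumSqCount_zero, sub_eq_zero, Finset.filter_filter, eq_comm (a := c)]

open Classical in
theorem card_fiber_ringHom [Fintype R] [Fintype S] (f : R →+* S)
    (hf : Function.Surjective f) (s : S) : #{x | f x = s} = #{x | f x = 0} :=
  AddMonoidHom.card_fiber_eq_of_mem_range f.toAddMonoidHom (hf s) (hf 0)

open Classical in
theorem card_eq_card_mul_card_fiber [Fintype R] [Fintype S] (f : R →+* S)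
    (hf : Function.Surjective f) : Fintype.card R = Fintype.card S * #{x | f x = 0} := by
  rw [← card_univ, Finset.card_eq_sum_card_fiberwise (f := f) (t := univ) (by simp)]
  simp [card_fiber_ringHom f hf]

/-- Hensel lifting of square roots of units, in counting form. -/
theorem existsUnique_sq_eq_of_isLocalHom [Finite R] [Finite S] (f : R →+* S)
    (hf : Function.Surjective f) [IsLocalHom f] (h2 : IsUnit (2 : S)) {v : S} (hv : IsUnit v)
    {s : R} (hs : f s = v ^ 2) : ∃! u, f u = v ∧ u ^ 2 = s := by
  classical
  have := Fintype.ofFinite R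
  have := Fintype.ofFinite S
  have hinj : Set.InjOn (fun u : R ↦ u ^ 2) {u | f u = v} := by
    intro x hx y hy hxy
    have hu : IsUnit (x + y) := by
      apply IsUnit.of_map f
      rw [map_add, hx, hy, ← two_mul]
      exact h2.mul hv
    have : (x + y) * (x - y) = 0 := by
      simp only at hxy
      linear_combination hxy
    exact sub_eq_zero.1 (hu.mul_right_eq_zero.1 this)
  have himg : image (fun u : R ↦ u ^ 2) {u | f u = v} = ({u | f u = v ^ 2} : Finset R) := by
    apply Finset.eq_of_subset_of_card_le
    · intro y
      simp only [mem_image, mem_filter, mem_univ, true_and]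
      rintro ⟨x, hx, rfl⟩
      rw [map_pow, hx]
    · rw [Finset.card_image_of_injOn (by simpa using hinj), card_fiber_ringHom f hf v,
        card_fiber_ringHom f hf]
  have hmem : s ∈ image (fun u : R ↦ u ^ 2) {u | f u = v} := by simp [himg, hs]
  obtain ⟨u, hu, rfl⟩ := Finset.mem_image.1 hmem
  simp only [mem_filter, mem_univ, true_and] at hu
  exact ⟨u, ⟨hu, rfl⟩, fun w hw ↦ hinj hw.1 hu hw.2⟩

theorem isUnit_one_sub_map_iff (f : R →+* S) [IsLocalHom f] (u : R) :
    IsUnit (1 - f u) ↔ IsUnit (1 - u) := by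
  rw [← map_one f, ← map_sub, isUnit_map_iff]

open Classical in
theorem sumSqCount_one_map [Fintype R] [Fintype S] (f : R →+* S)
    (hf : Function.Surjective f) [IsLocalHom f] (h2 : IsUnit (2 : S)) (c : R) :
    sumSqCount R 1 c = sumSqCount S 1 (f c) := by
  rw [sumSqCount_one, sumSqCount_one]
  refine Finset.card_bij (fun u _ ↦ f u) ?_ ?_ ?_
  · intro u
    simp only [mem_filter, mem_univ, true_and, isUnit_one_sub_map_iff, isUnit_map_iff]
    rintro ⟨h, rfl⟩
    exact ⟨h, (map_pow f u 2).symm⟩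
  · simp only [mem_filter, mem_univ, true_and]
    intro u hu w hw huw
    exact (existsUnique_sq_eq_of_isLocalHom f hf h2 (hu.1.1.map f)
      (by rw [← hu.2, map_pow])).unique ⟨rfl, hu.2⟩ ⟨huw.symm, hw.2⟩
  · simp only [mem_filter, mem_univ, true_and]
    intro v hv
    obtain ⟨u, ⟨rfl, hu⟩, -⟩ := existsUnique_sq_eq_of_isLocalHom f hf h2 hv.1.1 hv.2.symm
    rw [isUnit_one_sub_map_iff, isUnit_map_iff] at hv
    exact ⟨u, ⟨hv.1, hu⟩, rfl⟩

open Classical in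
theorem sumSqCount_map [Fintype R] [Fintype S] (f : R →+* S)
    (hf : Function.Surjective f) [IsLocalHom f] (h2 : IsUnit (2 : S)) (k : ℕ) (c : R) :
    sumSqCount R (k + 1) c = #{x | f x = 0} ^ k * sumSqCount S (k + 1) (f c) := by
  induction k generalizing c with
  | zero => simp [sumSqCount_one_map f hf h2]
  | succ k ih =>
    rw [sumSqCount_succ, sumSqCount_succ _ (f c)]
    simp only [ih, map_sub, map_pow]
    rw [← Finset.mul_sum, pow_succ, mul_assoc]
    congr 1
    rw [Finset.mul_sum]
    rw [← Finset.sum_fiberwise_of_maps_to (g := f) (t := {v | IsUnit v ∧ IsUnit (1 - v)})]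
    · refine Finset.sum_congr rfl fun v hv ↦ ?_
      rw [← card_fiber_ringHom f hf v, ← smul_eq_mul, ← Finset.sum_const]
      simp only [mem_filter, mem_univ, true_and] at hv
      refine Finset.sum_congr ?_ ?_
      · ext u
        simp only [mem_filter, mem_univ, true_and, and_iff_right_iff_imp]
        rintro rfl
        rwa [isUnit_one_sub_map_iff, isUnit_map_iff] at hv
      · simp +contextual
    · simp [isUnit_one_sub_map_iff]

end SumSqCount

theorem excCount_two (k : ℕ) (c : ℤ) (n : ℕ) :
    excCount k c 2 n = sumSqCount (ZMod n) k c := rfl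

theorem excCount_mul (k : ℕ) (c : ℤ) {m n : ℕ} (h : m.Coprime n) :
    excCount k c 2 (m * n) = excCount k c 2 m * excCount k c 2 n := by
  have := sumSqCount_congr (ZMod.chineseRemainder h) k c
  rw [sumSqCount_prod, map_intCast] at this
  exact this.symm

theorem excCount_one (k : ℕ) (c : ℤ) : excCount k c 2 1 = 1 := by
  have (x : Fin k → ZMod 1) : (∀ i, IsUnit (x i) ∧ IsUnit (1 - x i)) ∧
      ∑ i, x i ^ 2 = (c : ZMod 1) :=
    ⟨fun _ ↦ ⟨isUnit_of_subsingleton _, isUnit_of_subsingleton _⟩, Subsingleton.elim _ _⟩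
  rw [excCount, Nat.card_congr (Equiv.subtypeUnivEquiv this)]
  simp

theorem isLocalHom_castHom_prime_pow (p a : ℕ) [Fact p.Prime] :
    IsLocalHom (ZMod.castHom (dvd_pow_self p (Nat.add_one_ne_zero a)) (ZMod p)) := by
  refine ⟨fun x hx ↦ ?_⟩
  obtain ⟨m, rfl⟩ := ZMod.natCast_zmod_surjective x
  rw [map_natCast, ZMod.isUnit_iff_coprime] at hx
  rw [ZMod.isUnit_iff_coprime]
  exact hx.pow_right _

theorem excCount_prime_pow (k : ℕ) (c : ℤ) {p : ℕ} [Fact p.Prime] (hp : p ≠ 2) (a : ℕ) :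
    excCount (k + 1) c 2 (p ^ (a + 1)) = (p ^ a) ^ k * excCount (k + 1) c 2 p := by
  classical
  set f := ZMod.castHom (dvd_pow_self p (Nat.add_one_ne_zero a)) (ZMod p)
  have hf : Function.Surjective f := ZMod.castHom_surjective _
  have := isLocalHom_castHom_prime_pow p a
  have h2 : IsUnit (2 : ZMod p) :=
    (Ring.two_ne_zero (by rwa [ZMod.ringChar_zmod_n])).isUnit
  have hcard : p ^ a = #{x | f x = 0} := by
    have := card_eq_card_mul_card_fiber f hf
    rw [ZMod.card, ZMod.card] at this
    refine Nat.eq_of_mul_eq_mul_left (NeZero.pos p) ((pow_succ' p a).symm.trans ?_)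
    convert this
  have := sumSqCount_map f hf h2 k c
  rw [map_intCast] at this
  rw [hcard, excCount_two, excCount_two]
  convert this

section Fourier

variable {F : Type*} [Field F] [Fintype F] [DecidableEq F]

/-- The quadratic character of `F` with values in `ℂ`. -/
noncomputable def quadraticCharComplex (F : Type*) [Field F] [Fintype F] [DecidableEq F] :
    MulChar F ℂ :=
  (quadraticChar F).ringHomComp (Int.castRingHom ℂ)

theorem quadraticCharComplex_apply (a : F) :
    quadraticCharComplex F a = (quadraticChar F a : ℂ) := rfl

theorem quadraticCharComplex_isQuadratic : (quadraticCharComplex F).IsQuadratic :=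
  (quadraticChar_isQuadratic F).comp _

theorem quadraticCharComplex_ne_one (hF : ringChar F ≠ 2) : quadraticCharComplex F ≠ 1 := by
  rw [quadraticCharComplex, ne_eq,
    MulChar.ringHomComp_eq_one_iff (RingHom.injective_int _)]
  exact quadraticChar_ne_one hF

theorem gaussSum_quadraticCharComplex_mulShift (hF : ringChar F ≠ 2) (ψ : AddChar F ℂ) (t : F) :
    gaussSum (quadraticCharComplex F) (ψ.mulShift t) =
      quadraticCharComplex F t * gaussSum (quadraticCharComplex F) ψ := by
  obtain rfl | ht := eq_or_ne t 0
  · rw [AddChar.mulShift_zero, gaussSum_one_right (quadraticCharComplex_ne_one hF)]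
    simp [MulChar.map_zero]
  · simpa [quadraticCharComplex_isQuadratic.inv] using
      gaussSum_mulShift_eq (quadraticCharComplex F) ψ (Units.mk0 t ht)

theorem sum_addChar_mul_sq (hF : ringChar F ≠ 2) {ψ : AddChar F ℂ} (hψ : ψ.IsPrimitive)
    {t : F} (ht : t ≠ 0) :
    ∑ x, ψ (t * x ^ 2) = quadraticCharComplex F t * gaussSum (quadraticCharComplex F) ψ := by
  rw [← gaussSum_quadraticCharComplex_mulShift hF ψ, gaussSum,
    ← Finset.sum_fiberwise (g := fun x : F ↦ x ^ 2)]
  have h (y : F) : ∑ x with x ^ 2 = y, ψ (t * x ^ 2) =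
      quadraticCharComplex F y * ψ (t * y) + ψ (y * t) := by
    have hc : (#{x : F | x ^ 2 = y} : ℂ) = quadraticCharComplex F y + 1 := by
      rw [quadraticCharComplex_apply]
      have := quadraticChar_card_sqrts hF y
      rw [show {x : F | x ^ 2 = y}.toFinset = ({x | x ^ 2 = y} : Finset F) by ext; simp] at this
      exact_mod_cast this
    rw [Finset.sum_congr rfl (g := fun _ ↦ ψ (t * y)) (by simp +contextual), Finset.sum_const,
      nsmul_eq_mul, hc, mul_comm y t]
    ring
  simp only [h, Finset.sum_add_distrib, AddChar.sum_mulShift _ hψ, ht, if_false,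
    AddChar.mulShift_apply, Nat.cast_zero, add_zero]

open Classical in
theorem sum_exceptional_unit (g : F → ℂ) :
    ∑ x with IsUnit x ∧ IsUnit (1 - x), g x = ∑ x, g x - g 0 - g 1 := by
  have h : ({x | IsUnit x ∧ IsUnit (1 - x)} : Finset F) = (univ.erase 0).erase 1 := by
    ext x
    simp [sub_eq_zero, eq_comm (a := (1 : F)), and_comm]
  rw [h, Finset.sum_erase_eq_sub (by simp), Finset.sum_erase_eq_sub (by simp)]

omit [Fintype F] [DecidableEq F] in
theorem addChar_map_sum {ι : Type*} (ψ : AddChar F ℂ) (s : Finset ι) (f : ι → F) :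
    ψ (∑ i ∈ s, f i) = ∏ i ∈ s, ψ (f i) := by
  induction s using Finset.cons_induction with
  | empty => simp
  | cons a s ha ih => rw [Finset.sum_cons, Finset.prod_cons, AddChar.map_add_eq_mul, ih]

open Classical in
theorem card_mul_sumSqCount {ψ : AddChar F ℂ} (hψ : ψ.IsPrimitive) (k : ℕ) (c : F) :
    (Fintype.card F : ℂ) * sumSqCount F k c =
      ∑ t, ψ (-(t * c)) * (∑ x with IsUnit x ∧ IsUnit (1 - x), ψ (t * x ^ 2)) ^ k := by
  have hprod (t : F) (x : Fin k → F) :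
      ψ (-(t * c)) * ∏ i, ψ (t * x i ^ 2) = ψ (t * (∑ i, x i ^ 2 - c)) := by
    rw [← addChar_map_sum, ← AddChar.map_add_eq_mul, ← Finset.mul_sum]
    ring_nf
  simp only [Finset.sum_pow', Finset.mul_sum, hprod]
  rw [Finset.sum_comm]
  simp only [AddChar.sum_mulShift _ hψ, sub_eq_zero]
  rw [sumSqCount, Nat.card_eq_fintype_card, Fintype.card_subtype]
  simp only [Nat.cast_ite, Nat.cast_zero]
  rw [← Finset.sum_filter, Finset.sum_const, nsmul_eq_mul, mul_comm]
  congr 2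
  congr 1
  ext x
  simp [Fintype.mem_piFinset]

omit [Fintype F] [DecidableEq F] in
theorem addChar_mul_one_add_pow (ψ : AddChar F ℂ) (n : ℕ) (t c : F) :
    ψ (-(t * c)) * (1 + ψ t) ^ n = ∑ j ∈ range (n + 1), (n.choose j : ℂ) * ψ (t * (j - c)) := by
  rw [add_comm 1 (ψ t), add_pow, Finset.mul_sum]
  refine Finset.sum_congr rfl fun j _ ↦ ?_
  rw [one_pow, mul_one, ← AddChar.map_nsmul_eq_pow, ← mul_assoc, ← AddChar.map_add_eq_mul,
    mul_comm, nsmul_eq_mul]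
  ring_nf

theorem sum_addChar_mul_one_add_pow {ψ : AddChar F ℂ} (hψ : ψ.IsPrimitive) (n : ℕ) (c : F) :
    ∑ t ∈ univ.erase 0, ψ (-(t * c)) * (1 + ψ t) ^ n =
      Fintype.card F * (∑ j ∈ range (n + 1) with ((j : ℕ) - c : F) = 0, (n.choose j : ℂ)) - 2 ^ n := by
  rw [Finset.sum_erase_eq_sub (mem_univ _)]
  congr 1
  · simp only [addChar_mul_one_add_pow]
    rw [Finset.sum_comm]
    simp only [← Finset.mul_sum, AddChar.sum_mulShift _ hψ, Nat.cast_ite, Nat.cast_zero,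
      mul_ite, mul_zero]
    rw [← Finset.sum_filter, ← Finset.sum_mul, mul_comm]
  · norm_num

theorem sum_quadraticChar_mul_addChar_mul_one_add_pow (hF : ringChar F ≠ 2) (ψ : AddChar F ℂ)
    (n : ℕ) (c : F) :
    ∑ t ∈ univ.erase 0, quadraticCharComplex F t * (ψ (-(t * c)) * (1 + ψ t) ^ n) =
      gaussSum (quadraticCharComplex F) ψ *
        ∑ j ∈ range (n + 1), (n.choose j : ℂ) * quadraticCharComplex F (j - c) := by
  rw [Finset.sum_erase _ (by simp [MulChar.map_zero])]
  simp only [addChar_mul_one_add_pow, Finset.mul_sum]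
  rw [Finset.sum_comm]
  refine Finset.sum_congr rfl fun j _ ↦ ?_
  rw [mul_left_comm, mul_comm (gaussSum _ _), ← gaussSum_quadraticCharComplex_mulShift hF ψ,
    gaussSum, Finset.mul_sum]
  refine Finset.sum_congr rfl fun t _ ↦ ?_
  rw [AddChar.mulShift_apply, mul_comm t, mul_left_comm]

theorem sum_range_succ_even_add_odd {M : Type*} [AddCommMonoid M] (f : ℕ → M) (k : ℕ) :
    ∑ m ∈ range (k + 2), f m =
      ∑ i ∈ range ((k + 1) / 2 + 1), f (2 * i) + ∑ i ∈ range (k / 2 + 1), f (2 * i + 1) := by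
  induction k with
  | zero => simp [Finset.sum_range_succ]
  | succ k ih =>
    rw [Finset.sum_range_succ, ih]
    obtain ⟨m, rfl | rfl⟩ := k.even_or_odd'
    · rw [show (2 * m + 1 + 1) / 2 = m + 1 by lia, show (2 * m + 1) / 2 = m by lia,
        show 2 * m / 2 = m by lia, Finset.sum_range_succ _ (m + 1), add_right_comm]
      rfl
    · rw [show (2 * m + 1 + 1 + 1) / 2 = m + 1 by lia, show (2 * m + 1 + 1) / 2 = m + 1 by lia,
        show (2 * m + 1) / 2 = m by lia,
        Finset.sum_range_succ (fun i ↦ f (2 * i + 1)) (m + 1), add_assoc]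
      rfl

theorem card_mul_sumSqCount_eq (hF : ringChar F ≠ 2) (k : ℕ) (c : F) {ψ : AddChar F ℂ}
    (hψ : ψ.IsPrimitive) :
    (Fintype.card F : ℂ) * sumSqCount F (k + 1) c =
      (-1) ^ (k + 1) *
        ((2 - (Fintype.card F : ℂ)) ^ (k + 1)
          - ∑ i ∈ range ((k + 1) / 2 + 1),
            (quadraticCharComplex F (-1) * Fintype.card F) ^ i * ((k + 1).choose (2 * i)) *
              (2 ^ (k + 1 - 2 * i) - Fintype.card F *
                ∑ j ∈ range (k + 1 - 2 * i + 1) with ((j : ℕ) - c : F) = 0,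
                  ((k + 1 - 2 * i).choose j : ℂ))
          - ∑ i ∈ range (k / 2 + 1),
            (quadraticCharComplex F (-1) * Fintype.card F) ^ (i + 1) *
              ((k + 1).choose (2 * i + 1)) *
              ∑ j ∈ range (k + 1 - (2 * i + 1) + 1),
                ((k + 1 - (2 * i + 1)).choose j : ℂ) * quadraticCharComplex F (j - c)) := by
  classical
  set χ := quadraticCharComplex F with hχ
  set G := gaussSum χ ψ
  have hG2 : G ^ 2 = χ (-1) * Fintype.card F :=
    gaussSum_sq (quadraticCharComplex_ne_one hF) quadraticCharComplex_isQuadratic hψ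
  have hχ2 {t : F} (ht : t ∈ univ.erase 0) : χ t ^ 2 = 1 := by
    rw [hχ, quadraticCharComplex_apply]
    exact_mod_cast quadraticChar_sq_one (Finset.ne_of_mem_erase ht)
  have hterm {t : F} (ht : t ∈ univ.erase 0) :
      ψ (-(t * c)) * (∑ x with IsUnit x ∧ IsUnit (1 - x), ψ (t * x ^ 2)) ^ (k + 1) =
        (-1) ^ (k + 1) * ∑ m ∈ range (k + 2), (-(χ t * G)) ^ m *
          (ψ (-(t * c)) * (1 + ψ t) ^ (k + 1 - m)) * ((k + 1).choose m) := by
    rw [sum_exceptional_unit, sum_addChar_mul_sq hF hψ (Finset.ne_of_mem_erase ht)]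
    have : χ t * G - ψ (t * 0 ^ 2) - ψ (t * 1 ^ 2) = -1 * (-(χ t * G) + (1 + ψ t)) := by
      simp
      ring
    rw [this, mul_pow, add_pow, mul_left_comm, Finset.mul_sum]
    congr 1
    refine Finset.sum_congr rfl fun m _ ↦ ?_
    ring
  rw [card_mul_sumSqCount hψ, ← Finset.add_sum_erase _ _ (mem_univ 0),
    Finset.sum_congr rfl fun t ht ↦ hterm ht, ← Finset.mul_sum, Finset.sum_comm,
    sum_range_succ_even_add_odd]
  have h0 : ψ (-(0 * c)) * (∑ x with IsUnit x ∧ IsUnit (1 - x), ψ (0 * x ^ 2)) ^ (k + 1) =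
      (-1) ^ (k + 1) * (2 - (Fintype.card F : ℂ)) ^ (k + 1) := by
    rw [sum_exceptional_unit, ← mul_pow]
    simp
    ring
  have heven (i : ℕ) : ∑ t ∈ univ.erase 0, (-(χ t * G)) ^ (2 * i) *
        (ψ (-(t * c)) * (1 + ψ t) ^ (k + 1 - 2 * i)) * ((k + 1).choose (2 * i)) =
      -((χ (-1) * Fintype.card F) ^ i * ((k + 1).choose (2 * i)) *
        (2 ^ (k + 1 - 2 * i) - Fintype.card F *
          ∑ j ∈ range (k + 1 - 2 * i + 1) with ((j : ℕ) - c : F) = 0,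
            ((k + 1 - 2 * i).choose j : ℂ))) := by
    rw [← mul_neg, neg_sub, ← sum_addChar_mul_one_add_pow hψ, Finset.mul_sum]
    refine Finset.sum_congr rfl fun t ht ↦ ?_
    rw [pow_mul, neg_sq, mul_pow, hχ2 ht, one_mul, hG2]
    ring
  have hodd (i : ℕ) : ∑ t ∈ univ.erase 0, (-(χ t * G)) ^ (2 * i + 1) *
        (ψ (-(t * c)) * (1 + ψ t) ^ (k + 1 - (2 * i + 1))) * ((k + 1).choose (2 * i + 1)) =
      -((χ (-1) * Fintype.card F) ^ (i + 1) * ((k + 1).choose (2 * i + 1)) *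
        ∑ j ∈ range (k + 1 - (2 * i + 1) + 1),
          ((k + 1 - (2 * i + 1)).choose j : ℂ) * χ (j - c)) := by
    rw [← hG2, ← pow_mul, mul_add, mul_one, pow_add _ _ 2, sq, ← mul_assoc, mul_right_comm _ G,
      mul_assoc _ G, ← sum_quadraticChar_mul_addChar_mul_one_add_pow hF ψ, Finset.mul_sum,
      ← Finset.sum_neg_distrib]
    refine Finset.sum_congr rfl fun t ht ↦ ?_
    rw [pow_succ, pow_mul, neg_sq, mul_pow, hχ2 ht, one_mul, ← pow_mul]
    ring
  simp only [h0, heven, hodd, Finset.sum_neg_distrib]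
  ring

end Fourier

theorem quadraticCharComplex_zmod_intCast (p : ℕ) [Fact p.Prime] (a : ℤ) :
    quadraticCharComplex (ZMod p) a = (jacobiSym a p : ℂ) := by
  rw [quadraticCharComplex_apply, ← jacobiSym.legendreSym.to_jacobiSym, legendreSym]

theorem quadraticCharComplex_zmod_neg_one {p : ℕ} [Fact p.Prime] (hp : p ≠ 2) :
    quadraticCharComplex (ZMod p) (-1) = (-1) ^ (p / 2) := by
  rw [quadraticCharComplex_apply, quadraticChar_neg_one (by rwa [ZMod.ringChar_zmod_n]),
    ZMod.card, ZMod.χ₄_eq_neg_one_pow (Nat.odd_iff.1 ((Fact.out : p.Prime).odd_of_ne_two hp))]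
  norm_num

theorem card_mul_excCount_prime (k : ℕ) (c : ℤ) {p : ℕ} [Fact p.Prime] (hp : p ≠ 2) :
    (p : ℚ) * excCount (k + 1) c 2 p =
      (-1) ^ (k + 1) *
        ((2 - (p : ℚ)) ^ (k + 1)
          - ∑ i ∈ range ((k + 1) / 2 + 1),
            (-1) ^ ((p - 1) * i / 2) * (p : ℚ) ^ i * ((k + 1).choose (2 * i) : ℚ) *
              (2 ^ (k + 1 - 2 * i) - (p : ℚ) *
                ∑ j ∈ range (k + 1 - 2 * i + 1) with (p : ℤ) ∣ ((j : ℕ) : ℤ) - c,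
                  ((k + 1 - 2 * i).choose j : ℚ))
          - ∑ i ∈ range (k / 2 + 1),
            (-1) ^ ((p - 1) * (i + 1) / 2) * (p : ℚ) ^ (i + 1) *
              ((k + 1).choose (2 * i + 1) : ℚ) *
              ∑ j ∈ range (k + 1 - 2 * i - 1 + 1) with ¬ (p : ℤ) ∣ ((j : ℕ) : ℤ) - c,
                ((k + 1 - 2 * i - 1).choose j : ℚ) * (jacobiSym ((j : ℤ) - c) p : ℚ)) := by
  have key := card_mul_sumSqCount_eq (F := ZMod p) (by rwa [ZMod.ringChar_zmod_n]) k c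
    (ZMod.isPrimitive_stdAddChar p)
  have hzero (j : ℕ) : ((j : ZMod p) - (c : ZMod p) = 0) ↔ (p : ℤ) ∣ (j : ℤ) - c := by
    rw [← ZMod.intCast_zmod_eq_zero_iff_dvd]
    push_cast
    rfl
  have hjac (j : ℕ) : quadraticCharComplex (ZMod p) ((j : ZMod p) - (c : ZMod p)) =
      (jacobiSym ((j : ℤ) - c) p : ℂ) := by
    rw [← quadraticCharComplex_zmod_intCast]
    push_cast
    rfl
  have hsign (i : ℕ) : (-1 : ℂ) ^ ((p - 1) * i / 2) * (p : ℂ) ^ i =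
      (quadraticCharComplex (ZMod p) (-1) * p) ^ i := by
    obtain ⟨q, hq⟩ := (Fact.out : p.Prime).odd_of_ne_two hp
    rw [quadraticCharComplex_zmod_neg_one hp, mul_pow, ← pow_mul,
      show (p - 1) * i = 2 * (q * i) by rw [hq, Nat.add_sub_cancel, mul_assoc],
      Nat.mul_div_cancel_left _ two_pos, show p / 2 = q by lia]
  have hfilter (n : ℕ) (g : ℕ → ℂ) :
      ∑ j ∈ range n with ¬ (p : ℤ) ∣ ((j : ℕ) : ℤ) - c, g j * (jacobiSym ((j : ℤ) - c) p : ℂ) =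
        ∑ j ∈ range n, g j * (jacobiSym ((j : ℤ) - c) p : ℂ) := by
    refine Finset.sum_filter_of_ne fun j _ hj hdvd ↦ hj ?_
    rw [← hjac, (hzero j).2 hdvd, MulChar.map_zero, mul_zero]
  rw [← (Rat.cast_injective (α := ℂ)).eq_iff]
  push_cast
  simp only [hsign, hfilter, Nat.sub_sub]
  simp only [ZMod.card, hzero, hjac] at key
  exact key

end

/-- For an odd prime `p` dividing the odd number `n`, `jacobiSym a p` is the
Legendre symbol `(a/p)`. -/
theorem excCount_formula (n : ℕ) (hn : 1 ≤ n) (hodd : Odd n)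
    (k : ℕ) (hk : 2 ≤ k) (c : ℤ) :
    (excCount k c 2 n : ℚ) =
      (-1) ^ (k * n.primeFactors.card) *
        ∏ p ∈ n.primeFactors,
          (p : ℚ) ^ ((k : ℤ) * (n.factorization p : ℤ) - (n.factorization p : ℤ) - (k : ℤ)) *
            ((2 - (p : ℚ)) ^ k
              - ∑ i ∈ Finset.range (k / 2 + 1),
                  (-1 : ℚ) ^ ((p - 1) * i / 2) * (p : ℚ) ^ i * (k.choose (2 * i) : ℚ) *
                    ((2 : ℚ) ^ (k - 2 * i)
                      - (p : ℚ) *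
                        ∑ j ∈ (Finset.range (k - 2 * i + 1)).filter
                            (fun (j : ℕ) => (p : ℤ) ∣ (j : ℤ) - c),
                          ((k - 2 * i).choose j : ℚ))
              - ∑ i ∈ Finset.range ((k - 1) / 2 + 1),
                  (-1 : ℚ) ^ ((p - 1) * (i + 1) / 2) * (p : ℚ) ^ (i + 1) *
                    (k.choose (2 * i + 1) : ℚ) *
                    ∑ j ∈ (Finset.range (k - 2 * i - 1 + 1)).filter
                        (fun (j : ℕ) => ¬ (p : ℤ) ∣ (j : ℤ) - c),
                      ((k - 2 * i - 1).choose j : ℚ) * (jacobiSym ((j : ℤ) - c) p : ℚ)) := by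
  have hmul := Nat.multiplicative_factorization (fun m ↦ excCount k c 2 m)
    (fun _ _ h ↦ excCount_mul k c h) (excCount_one k c) (Nat.one_le_iff_ne_zero.1 hn)
  rw [hmul, Finsupp.prod, Nat.support_factorization, Nat.cast_prod, pow_mul, ← Finset.prod_const,
    ← Finset.prod_mul_distrib]
  refine Finset.prod_congr rfl fun p hp ↦ ?_
  have hpn := Nat.dvd_of_mem_primeFactors hp
  have : Fact p.Prime := ⟨Nat.prime_of_mem_primeFactors hp⟩
  have hp2 : p ≠ 2 := by
    rintro rfl
    exact Nat.not_even_iff_odd.2 hodd (even_iff_two_dvd.2 hpn)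
  obtain ⟨k, rfl⟩ : ∃ l, k = l + 1 := ⟨k - 1, by lia⟩
  obtain ⟨a, ha⟩ : ∃ a, n.factorization p = a + 1 :=
    Nat.exists_eq_add_one.2 (this.out.factorization_pos_of_dvd (by lia) hpn)
  have hp0 : (p : ℚ) ≠ 0 := NeZero.ne _
  have hpow : (p : ℚ) ^ (((k + 1 : ℕ) : ℤ) * ((a + 1 : ℕ) : ℤ) - ((a + 1 : ℕ) : ℤ) -
      ((k + 1 : ℕ) : ℤ)) = (p ^ a) ^ k * (p : ℚ)⁻¹ := by
    rw [← pow_mul, ← zpow_natCast, ← zpow_sub_one₀ hp0]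
    congr 1
    push_cast
    ring
  rw [ha, excCount_prime_pow k c hp2, hpow]
  push_cast
  rw [mul_assoc ((p ^ a : ℚ) ^ k), mul_left_comm, mul_left_comm (_ ^ (k + 1))]
  congr 1
  rw [eq_inv_mul_iff_mul_eq₀ hp0, card_mul_excCount_prime k c hp2]
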